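/- arXiv:2502.11790 — 2 statements merged into one kernel-verified Lean document; each statement's English description precedes it below -/
import Mathlib

section
/- For every permutation w of {1,…,n+1}, the number of w-relevant pairs (p,q) with 1 ≤ p ≤ n+1, 1 ≤ q ≤ n equals the length ℓ(w) of w. -/
/-- `r^w_{p,q} = #{k : 1 ≤ k ≤ q, w(k) ≤ p}` for a permutation `w` of `{1, …, n+1}`
(realised as a permutation of `Fin (n+1)`, with `k ∈ Fin (n+1)` corresponding to the
1-indexed entry `k+1`). The conventions `r^w_{0,q} = r^w_{p,0} = 0` hold automatically. -/
def rnum (n : ℕ) (w : Equiv.Perm (Fin (n+1))) (p q : ℕ) : ℕ :=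
  ((Finset.univ : Finset (Fin (n+1))).filter
    (fun k : Fin (n+1) => (k : ℕ) + 1 ≤ q ∧ (w k : ℕ) + 1 ≤ p)).card

/-- The length `ℓ(w)`: the number of inversions of `w`. -/
def pLen (n : ℕ) (w : Equiv.Perm (Fin (n+1))) : ℕ :=
  ((Finset.univ : Finset (Fin (n+1) × Fin (n+1))).filter
    (fun ij : Fin (n+1) × Fin (n+1) => ij.1 < ij.2 ∧ w ij.2 < w ij.1)).card

/-- The simple transposition `s_i` swapping `i` and `i+1` (1-indexed), as a permutation
of `Fin (n+1)`; it is defined to be the identity for `i` outside `{1, …, n}`. -/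
def sT (n : ℕ) (i : ℕ) : Equiv.Perm (Fin (n+1)) :=
  if h : 1 ≤ i ∧ i ≤ n then Equiv.swap ⟨i - 1, by omega⟩ ⟨i, by omega⟩ else 1

/-- The finite set of `w`-relevant pairs `(p,q)`: `1 ≤ p ≤ n+1`, `1 ≤ q ≤ n`,
`r^w_{p,q} < p`, `r^w_{p,q} > r^w_{p-1,q}` and `r^w_{p,q} > r^w_{p,q-1}`. -/
def relevantFinset (n : ℕ) (w : Equiv.Perm (Fin (n+1))) : Finset (ℕ × ℕ) :=
  ((Finset.Icc 1 (n+1)) ×ˢ (Finset.Icc 1 n)).filter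
    (fun pq => rnum n w pq.1 pq.2 < pq.1 ∧
      rnum n w (pq.1 - 1) pq.2 < rnum n w pq.1 pq.2 ∧
      rnum n w pq.1 (pq.2 - 1) < rnum n w pq.1 pq.2)

/-- `L = [i_N, …, i_1]` is a reduced decomposition of `w`: all the letters lie in
`{1, …, n}`, `w = s_{i_N} ∘ ⋯ ∘ s_{i_1}`, and `N = ℓ(w)`. -/
def IsReducedWord (n : ℕ) (w : Equiv.Perm (Fin (n+1))) (L : List ℕ) : Prop :=
  (∀ i ∈ L, 1 ≤ i ∧ i ≤ n) ∧ (L.map (sT n)).prod = w ∧ L.length = pLen n w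

/-- A reduced decomposition `L = [i_N, …, i_1]` of `w` is geometrically compatible if the
multiset of its letters equals the multiset of values `r^w_{p,q}` over the `w`-relevant
pairs `(p,q)`. -/
def IsGeomCompatible (n : ℕ) (w : Equiv.Perm (Fin (n+1))) (L : List ℕ) : Prop :=
  IsReducedWord n w L ∧
    (L : Multiset ℕ) = (relevantFinset n w).val.map (fun pq => rnum n w pq.1 pq.2)


lemma card_filter_lt_iff {α : Type*} [Fintype α] (P Q : α → Prop) [DecidablePred P]
    [DecidablePred Q] (h : ∀ k, P k → Q k) :
    (Finset.univ.filter P).card < (Finset.univ.filter Q).card ↔ ∃ k, Q k ∧ ¬ P k := by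
  have hsub : Finset.univ.filter P ⊆ Finset.univ.filter Q := by
    intro k hk
    simp only [Finset.mem_filter, Finset.mem_univ, true_and] at hk ⊢
    exact h k hk
  constructor
  · intro hlt
    by_contra hne
    push Not at hne
    have : Finset.univ.filter Q ⊆ Finset.univ.filter P := by
      intro k hk
      simp only [Finset.mem_filter, Finset.mem_univ, true_and] at hk ⊢
      exact hne k hk
    have := Finset.card_le_card this
    omega
  · rintro ⟨k, hQ, hP⟩
    apply Finset.card_lt_card
    refine (Finset.ssubset_iff_of_subset hsub).2 ⟨k, ?_, ?_⟩ <;> simp [hQ, hP]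

lemma card_values_le (n : ℕ) (w : Equiv.Perm (Fin (n+1))) (a : Fin (n+1)) :
    (Finset.univ.filter (fun k : Fin (n+1) => (w k : ℕ) + 1 ≤ (w a : ℕ) + 1)).card
      = (w a : ℕ) + 1 := by
  rw [← Fin.card_Iic (w a)]
  apply Finset.card_bij (fun k _ => w k)
  · intro k hk
    simpa using hk
  · intro a _ b _ h
    exact w.injective h
  · intro b hb
    exact ⟨w.symm b, by simpa using hb, by simp⟩

lemma rel_iff (n : ℕ) (w : Equiv.Perm (Fin (n+1))) (a b : Fin (n+1)) :
    (((w a : ℕ) + 1, (b : ℕ) + 1) ∈ relevantFinset n w) ↔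
      ((a ≤ b ∧ w b ≤ w a) ∧ ∃ k, w k ≤ w a ∧ b < k) := by
  have h1 : rnum n w ((w a : ℕ) + 1) ((b : ℕ) + 1) < (w a : ℕ) + 1 ↔
      ∃ k, w k ≤ w a ∧ b < k := by
    have := card_values_le n w a
    rw [rnum]
    conv_lhs => rhs; rw [← this]
    rw [card_filter_lt_iff _ _ (fun k hk => hk.2)]
    apply exists_congr
    intro k
    simp only [Fin.le_def, Fin.lt_def]
    omega
  have h2 : rnum n w ((w a : ℕ) + 1 - 1) ((b : ℕ) + 1) <
      rnum n w ((w a : ℕ) + 1) ((b : ℕ) + 1) ↔ a ≤ b := by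
    rw [rnum, rnum, card_filter_lt_iff _ _ (fun k hk => by omega)]
    constructor
    · rintro ⟨k, hk, hk'⟩
      have : w k = w a := by ext; omega
      have := w.injective this
      subst this
      rw [Fin.le_def]; omega
    · intro h
      rw [Fin.le_def] at h
      exact ⟨a, by omega, by omega⟩
  have h3 : rnum n w ((w a : ℕ) + 1) ((b : ℕ) + 1 - 1) <
      rnum n w ((w a : ℕ) + 1) ((b : ℕ) + 1) ↔ w b ≤ w a := by
    rw [rnum, rnum, card_filter_lt_iff _ _ (fun k hk => by omega)]
    constructor
    · rintro ⟨k, hk, hk'⟩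
      have : k = b := by ext; omega
      subst this
      rw [Fin.le_def]; omega
    · intro h
      rw [Fin.le_def] at h
      exact ⟨b, by omega, by omega⟩
  simp only [relevantFinset, Finset.mem_filter, Finset.mem_product, Finset.mem_Icc]
  rw [h1, h2, h3]
  constructor
  · rintro ⟨_, h, h', h''⟩
    exact ⟨⟨h', h''⟩, h⟩
  · rintro ⟨⟨h', h''⟩, k, hk, hbk⟩
    refine ⟨?_, ⟨k, hk, hbk⟩, h', h''⟩
    rw [Fin.lt_def] at hbk
    have := k.isLt
    have := (w a).isLt
    omega

/-- The number of `w`-relevant pairs `(p,q)` (with `1 ≤ p ≤ n+1`, `1 ≤ q ≤ n`) equals the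
length `ℓ(w)` of `w`. -/
theorem relevant_card_eq_length (n : ℕ) (w : Equiv.Perm (Fin (n+1))) :
    (relevantFinset n w).card = pLen n w := by
  classical
  let S : Finset (Fin (n+1) × Fin (n+1)) :=
    Finset.univ.filter (fun x => x.1 ≤ x.2 ∧ w x.2 ≤ w x.1)
  have hrel : (S.filter (fun x => ∃ k, w k ≤ w x.1 ∧ x.2 < k)).card
      = (relevantFinset n w).card := by
    apply Finset.card_bij (fun x _ => ((w x.1 : ℕ) + 1, (x.2 : ℕ) + 1))
    · rintro ⟨a, b⟩ hx
      rw [rel_iff]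
      simpa [S] using hx
    · rintro ⟨a, b⟩ _ ⟨c, d⟩ _ h
      simp only [Prod.mk.injEq, Nat.add_right_cancel_iff] at h
      exact Prod.ext (w.injective (Fin.ext h.1)) (Fin.ext h.2)
    · rintro ⟨p, q⟩ hpq
      have hpq' := hpq
      simp only [relevantFinset, Finset.mem_filter, Finset.mem_product, Finset.mem_Icc] at hpq'
      obtain ⟨⟨⟨hp, hp'⟩, hq, hq'⟩, -⟩ := hpq'
      have he : (((w (w.symm ⟨p - 1, by omega⟩) : Fin (n+1)) : ℕ) + 1,
          ((⟨q - 1, by omega⟩ : Fin (n+1)) : ℕ) + 1) = (p, q) := by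
        simp only [Equiv.apply_symm_apply, Prod.mk.injEq]
        omega
      refine ⟨(w.symm ⟨p - 1, by omega⟩, ⟨q - 1, by omega⟩), ?_, he⟩
      have := hpq
      rw [← he, rel_iff] at this
      simpa [S] using this
  have hbad : (S.filter (fun x => ¬ ∃ k, w k ≤ w x.1 ∧ x.2 < k)).card = n + 1 := by
    refine Eq.trans ?_ (Finset.card_fin (n+1))
    apply Finset.card_bij (fun x _ => x.1)
    · simp
    · rintro ⟨a, b⟩ hx ⟨c, d⟩ hy h
      simp only at h
      subst h
      simp only [S, Finset.mem_filter, Finset.mem_univ, true_and, not_exists, not_and,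
        not_lt] at hx hy
      exact Prod.ext rfl (le_antisymm (hy.2 b hx.1.2) (hx.2 d hy.1.2))
    · intro a _
      obtain ⟨b, hb, hmax⟩ := Finset.exists_max_image
        (Finset.univ.filter (fun k => w k ≤ w a)) id ⟨a, by simp⟩
      simp only [Finset.mem_filter, Finset.mem_univ, true_and, id] at hb hmax
      refine ⟨(a, b), ?_, rfl⟩
      simp only [S, Finset.mem_filter, Finset.mem_univ, true_and, not_exists, not_and, not_lt]
      exact ⟨⟨hmax a le_rfl, hb⟩, hmax⟩
  have hdiag : (S.filter (fun x => ¬ x.1 < x.2)).card = n + 1 := by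
    refine Eq.trans ?_ (Finset.card_fin (n+1))
    apply Finset.card_bij (fun x _ => x.1)
    · simp
    · rintro ⟨a, b⟩ hx ⟨c, d⟩ hy h
      simp only at h
      subst h
      simp only [S, Finset.mem_filter, Finset.mem_univ, true_and, not_lt] at hx hy
      exact Prod.ext rfl ((le_antisymm hx.2 hx.1.1).trans (le_antisymm hy.1.1 hy.2))
    · intro a _
      exact ⟨(a, a), by simp [S], rfl⟩
  have hinv : (S.filter (fun x => x.1 < x.2)).card = pLen n w := by
    rw [pLen]
    congr 1
    ext ⟨a, b⟩
    simp only [S, Finset.mem_filter, Finset.mem_univ, true_and]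
    constructor
    · rintro ⟨⟨_, h⟩, h'⟩
      exact ⟨h', lt_of_le_of_ne h (fun e => h'.ne' (w.injective e))⟩
    · rintro ⟨h, h'⟩
      exact ⟨⟨h.le, h'.le⟩, h⟩
  have e1 := Finset.card_filter_add_card_filter_not (s := S)
    (fun x => ∃ k, w k ≤ w x.1 ∧ x.2 < k)
  have e2 := Finset.card_filter_add_card_filter_not (s := S) (fun x => x.1 < x.2)
  omega
end

section
/- Let w be a permutation of {1,…,n+1}. If the values r^w_{p,q}, as (p,q) ranges over the w-relevant pairs, are pairwise distinct, then w admits a geometrically compatible reduced decomposition. -/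
theorem gc_pLen_swap (n : ℕ) (w : Equiv.Perm (Fin (n+1))) (a b : Fin (n+1))
    (hab : (b : ℕ) = a + 1) (hw : w b < w a) :
    pLen n (w * Equiv.swap a b) + 1 = pLen n w := by
  classical
  have hmem : (a, b) ∈ (Finset.univ : Finset (Fin (n+1) × Fin (n+1))).filter
      (fun ij : Fin (n+1) × Fin (n+1) => ij.1 < ij.2 ∧ w ij.2 < w ij.1) := by
    simp only [Finset.mem_filter, Finset.mem_univ, true_and]
    exact ⟨Fin.lt_def.2 (by omega), hw⟩
  unfold pLen
  rw [← Finset.card_erase_add_one hmem]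
  congr 1
  have key : ∀ x y : Fin (n+1), x < y → ¬ (x = a ∧ y = b) →
      Equiv.swap a b x < Equiv.swap a b y := by
    intro x y hxy hne
    simp only [Equiv.swap_apply_def]
    simp only [Fin.lt_def, Fin.ext_iff] at *
    split_ifs <;> omega
  apply Finset.card_nbij' (fun p => (Equiv.swap a b p.1, Equiv.swap a b p.2))
    (fun p => (Equiv.swap a b p.1, Equiv.swap a b p.2))
  · rintro ⟨x, y⟩ h
    rw [Finset.mem_coe, Finset.mem_filter] at h
    replace h := h.2
    simp only [Equiv.Perm.mul_apply] at h
    have hne : ¬ (x = a ∧ y = b) := by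
      rintro ⟨rfl, rfl⟩
      have h2 := h.2
      simp only [Equiv.swap_apply_left, Equiv.swap_apply_right] at h2
      exact absurd h2 (not_lt.2 hw.le)
    simp only [Finset.mem_coe, Finset.mem_erase, Finset.mem_filter, Finset.mem_univ, true_and,
      Prod.mk.injEq, ne_eq]
    refine ⟨?_, key x y h.1 hne, h.2⟩
    rintro ⟨h1, h2⟩
    have hx : x = b := by
      have := congrArg (Equiv.swap a b) h1
      simpa using this
    have hy : y = a := by
      have := congrArg (Equiv.swap a b) h2
      simpa using this
    have := h.1
    rw [hx, hy, Fin.lt_def] at this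
    omega
  · rintro ⟨x, y⟩ h
    simp only [Finset.mem_coe, Finset.mem_erase, Finset.mem_filter, Finset.mem_univ, true_and,
      Prod.mk.injEq, ne_eq] at h
    rw [Finset.mem_coe, Finset.mem_filter]
    refine ⟨Finset.mem_univ _, ?_⟩
    simp only [Equiv.Perm.mul_apply, Equiv.swap_apply_self]
    exact ⟨key x y h.2.1 h.1, h.2.2⟩
  · rintro ⟨x, y⟩ _
    simp
  · rintro ⟨x, y⟩ _
    simp

theorem gc_exists_reduced (n : ℕ) : ∀ (N : ℕ) (w : Equiv.Perm (Fin (n+1))), pLen n w = N →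
    ∃ L : List ℕ, IsReducedWord n w L := by
  intro N
  induction N with
  | zero =>
    intro w hw
    refine ⟨[], by simp, ?_, by simp [hw]⟩
    have hm : StrictMono w := by
      intro i j hij
      by_contra hc
      have hlt : w j < w i := lt_of_le_of_ne (not_lt.1 hc) (fun h => hij.ne' (w.injective h))
      unfold pLen at hw
      rw [Finset.card_eq_zero] at hw
      have : (i, j) ∈ (∅ : Finset (Fin (n+1) × Fin (n+1))) := by
        rw [← hw]; simp [hij, hlt]
      simp at this
    have h1 : (StrictMono.orderIsoOfSurjective w hm w.surjective) = OrderIso.refl _ :=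
      Subsingleton.elim _ _
    ext x
    have := congrArg (fun f => f x) h1
    simp at this
    simp [this]
  | succ N ih =>
    intro w hw
    have hd : ∃ i : Fin n, w i.succ < w i.castSucc := by
      by_contra hc
      push Not at hc
      have hm : StrictMono w := by
        rw [Fin.strictMono_iff_lt_succ]
        intro i
        exact lt_of_le_of_ne (hc i) (fun h => (Fin.castSucc_lt_succ (i := i)).ne (w.injective h))
      have : pLen n w = 0 := by
        unfold pLen
        rw [Finset.card_eq_zero, Finset.filter_eq_empty_iff]
        rintro ⟨x, y⟩ _ ⟨h1, h2⟩
        exact absurd (hm h1) (not_lt.2 h2.le)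
      omega
    obtain ⟨i, hi⟩ := hd
    have hl := gc_pLen_swap n w i.castSucc i.succ (by simp) hi
    obtain ⟨L, hL1, hL2, hL3⟩ := ih (w * Equiv.swap i.castSucc i.succ) (by omega)
    have hs : sT n (i + 1) = Equiv.swap i.castSucc i.succ := by
      unfold sT
      rw [dif_pos ⟨by omega, by omega⟩]
      congr 1
    refine ⟨L ++ [(i : ℕ) + 1], ?_, ?_, ?_⟩
    · intro j hj
      simp only [List.mem_append, List.mem_singleton] at hj
      rcases hj with hj | rfl
      · exact hL1 j hj
      · omega
    · simp [hL2, hs, mul_assoc]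
    · simp [hL3]; omega

theorem gc_preserve (n r : ℕ) (L : List ℕ) (hr : r ∉ L) (x : Fin (n+1)) :
    (((L.map (sT n)).prod x : Fin (n+1)) : ℕ) < r ↔ (x : ℕ) < r := by
  induction L with
  | nil => simp
  | cons i L ih =>
    simp only [List.mem_cons, not_or] at hr
    rw [← ih hr.2]
    simp only [List.map_cons, List.prod_cons, Equiv.Perm.mul_apply]
    generalize (L.map (sT n)).prod x = y
    unfold sT
    split_ifs with h
    · rw [Equiv.swap_apply_def]
      have := hr.1
      simp only [Fin.ext_iff]
      split_ifs <;> simp <;> omega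
    · simp

/-- If `(w i, q)` with `i ≤ q`, `w q ≤ w i`, and there is a later smaller value, it is relevant. -/
theorem gc_relevant (n : ℕ) (w : Equiv.Perm (Fin (n+1))) (i q j : Fin (n+1))
    (hiq : i ≤ q) (hw : w q ≤ w i) (hqj : q < j) (hj : w j < w i) :
    ((w i : ℕ) + 1, (q : ℕ) + 1) ∈ relevantFinset n w := by
  unfold relevantFinset
  simp only [Finset.mem_filter, Finset.mem_product, Finset.mem_Icc]
  refine ⟨⟨⟨by omega, by omega⟩, by omega, by omega⟩, ?_, ?_, ?_⟩
  · have h1 : ((Finset.univ : Finset (Fin (n+1))).filter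
        (fun k => (w k : ℕ) + 1 ≤ (w i : ℕ) + 1)).card = (w i : ℕ) + 1 := by
      rw [← Fin.card_Iic (w i)]
      apply Finset.card_bij (fun k _ => w k)
      · intro a ha
        simp at ha ⊢
        exact ha
      · intro a _ b _ h
        exact w.injective h
      · intro b hb
        refine ⟨w.symm b, ?_, by simp⟩
        simpa using hb
    unfold rnum
    conv_rhs => rw [← h1]
    apply Finset.card_lt_card
    rw [Finset.ssubset_iff_of_subset]
    · refine ⟨j, ?_, ?_⟩
      · simp; omega
      · simp; omega
    · intro k hk
      simp at hk ⊢
      exact hk.2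
  · unfold rnum
    apply Finset.card_lt_card
    rw [Finset.ssubset_iff_of_subset]
    · refine ⟨i, ?_, ?_⟩
      · simp; omega
      · simp
    · intro k hk
      simp at hk ⊢
      omega
  · unfold rnum
    apply Finset.card_lt_card
    rw [Finset.ssubset_iff_of_subset]
    · refine ⟨q, ?_, ?_⟩
      · simp; omega
      · simp
    · intro k hk
      simp at hk ⊢
      omega

theorem gc_card (n : ℕ) (w : Equiv.Perm (Fin (n+1))) :
    pLen n w ≤ (relevantFinset n w).card := by
  classical
  have hex : ∀ p : Fin (n+1) × Fin (n+1), ∃ q : Fin (n+1), p.1 < p.2 ∧ w p.2 < w p.1 →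
      p.1 ≤ q ∧ w q ≤ w p.1 ∧ q < p.2 ∧
        ∀ c, p.1 ≤ c → w c ≤ w p.1 → c < p.2 → c ≤ q := by
    rintro ⟨i, j⟩
    by_cases h : i < j ∧ w j < w i
    · obtain ⟨q, hq, hmax⟩ := Finset.exists_max_image
        ((Finset.univ : Finset (Fin (n+1))).filter (fun c => i ≤ c ∧ w c ≤ w i ∧ c < j)) id
        ⟨i, by simp [h.1]⟩
      simp at hq hmax
      exact ⟨q, fun _ => ⟨hq.1, hq.2.1, hq.2.2, hmax⟩⟩
    · exact ⟨i, fun h' => absurd h' h⟩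
  choose f hf using hex
  unfold pLen
  apply Finset.card_le_card_of_injOn (fun p => ((w p.1 : ℕ) + 1, (f p : ℕ) + 1))
  · intro p hp
    simp at hp
    obtain ⟨h1, h2, h3, _⟩ := hf p hp
    exact gc_relevant n w p.1 (f p) p.2 h1 h2 h3 hp.2
  · rintro ⟨i, j⟩ hp ⟨i', j'⟩ hp' h
    simp at hp hp'
    simp only [Prod.mk.injEq, Nat.add_right_cancel_iff] at h
    obtain ⟨h1, h2⟩ := h
    have hi : i = i' := w.injective (Fin.ext h1)
    subst hi
    have hq := Fin.ext h2
    obtain ⟨_, _, a3, a4⟩ := hf (i, j) hp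
    obtain ⟨_, _, b3, b4⟩ := hf (i, j') hp'
    rw [← hq] at b3 b4
    dsimp only at a3 a4 b3 b4
    rcases lt_trichotomy j j' with hlt | heq | hlt
    · exact absurd (b4 j hp.1.le hp.2.le hlt) (not_le.2 a3)
    · rw [heq]
    · exact absurd (a4 j' hp'.1.le hp'.2.le hlt) (not_le.2 b3)

theorem gc_mem (n : ℕ) (w : Equiv.Perm (Fin (n+1))) (p q : ℕ)
    (h : (p, q) ∈ relevantFinset n w) (L : List ℕ) (hL : (L.map (sT n)).prod = w) :
    rnum n w p q ∈ L := by
  by_contra hr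
  have hpres := fun x => gc_preserve n _ L hr x
  rw [hL] at hpres
  unfold relevantFinset at h
  simp only [Finset.mem_filter, Finset.mem_product, Finset.mem_Icc] at h
  obtain ⟨⟨⟨hp1, hp2⟩, hq1, hq2⟩, hlt, h1, h2⟩ := h
  -- position q has value at most p
  have hwq : (w ⟨q - 1, by omega⟩ : ℕ) + 1 ≤ p := by
    by_contra hc
    apply absurd h2
    rw [not_lt]
    unfold rnum
    apply Finset.card_le_card
    intro k hk
    simp at hk ⊢
    have : (k : ℕ) ≠ q - 1 := by
      intro hh
      have : k = ⟨q - 1, by omega⟩ := Fin.ext hh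
      rw [← this] at hc
      omega
    omega
  -- value p has position at most q
  have hwp : (w.symm ⟨p - 1, by omega⟩ : ℕ) + 1 ≤ q := by
    by_contra hc
    apply absurd h1
    rw [not_lt]
    unfold rnum
    apply Finset.card_le_card
    intro k hk
    simp at hk ⊢
    have : (w k : ℕ) ≠ p - 1 := by
      intro hh
      have : w k = ⟨p - 1, by omega⟩ := Fin.ext hh
      rw [← this] at hc
      simp at hc
      omega
    omega
  have hrq : rnum n w p q ≤ q := by
    have : (Finset.univ.filter (fun k : Fin (n+1) => (k : ℕ) < q)).card = q := by
      rw [Fin.card_filter_val_lt]; omega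
    conv_rhs => rw [← this]
    unfold rnum
    apply Finset.card_le_card
    intro k hk
    simp at hk ⊢
    omega
  have hcard : (Finset.univ.filter (fun k : Fin (n+1) => (k : ℕ) < rnum n w p q)).card
      = rnum n w p q := by
    rw [Fin.card_filter_val_lt]; omega
  have hsub : Finset.univ.filter (fun k : Fin (n+1) => (k : ℕ) < rnum n w p q) ⊆
      Finset.univ.filter (fun k : Fin (n+1) => (k : ℕ) + 1 ≤ q ∧ (w k : ℕ) + 1 ≤ p) := by
    intro k hk
    simp only [Finset.mem_filter, Finset.mem_univ, true_and] at hk ⊢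
    have := (hpres k).2 hk
    omega
  have heq := Finset.eq_of_subset_of_card_le hsub (by rw [hcard]; rfl)
  have m1 : (⟨q - 1, by omega⟩ : Fin (n+1)) ∈
      Finset.univ.filter (fun k : Fin (n+1) => (k : ℕ) < rnum n w p q) := by
    rw [heq]
    simp only [Finset.mem_filter, Finset.mem_univ, true_and]
    exact ⟨by omega, hwq⟩
  have m2 : w.symm ⟨p - 1, by omega⟩ ∈
      Finset.univ.filter (fun k : Fin (n+1) => (k : ℕ) < rnum n w p q) := by
    rw [heq]
    simp only [Finset.mem_filter, Finset.mem_univ, true_and, Equiv.apply_symm_apply]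
    exact ⟨hwp, by omega⟩
  simp only [Finset.mem_filter, Finset.mem_univ, true_and] at m2
  have := (hpres _).2 m2
  simp only [Equiv.apply_symm_apply] at this
  omega

/-- If the values `r^w_{p,q}`, as `(p,q)` ranges over the `w`-relevant pairs, are pairwise
distinct, then `w` admits a geometrically compatible reduced decomposition. -/
theorem exists_geomCompatible_of_distinct (n : ℕ) (w : Equiv.Perm (Fin (n+1)))
    (hdist : Set.InjOn (fun pq : ℕ × ℕ => rnum n w pq.1 pq.2) ↑(relevantFinset n w)) :
    ∃ L : List ℕ, IsGeomCompatible n w L := by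
  obtain ⟨L, hL⟩ := gc_exists_reduced n _ w rfl
  refine ⟨L, hL, ?_⟩
  symm
  apply Multiset.eq_of_le_of_card_le
  · rw [Multiset.le_iff_subset]
    · intro r hr
      simp only [Multiset.mem_map, Finset.mem_val] at hr
      obtain ⟨⟨p, q⟩, hpq, rfl⟩ := hr
      exact Multiset.mem_coe.2 (gc_mem n w p q hpq L hL.2.1)
    · exact Multiset.Nodup.map_on (fun x hx y hy h => hdist hx hy h) (relevantFinset n w).nodup
  · rw [Multiset.card_map, Multiset.coe_card, hL.2.2]
    exact gc_card n w
end
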